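/- Let R be a Noetherian ring, 𝔞 an ideal, and 0 → M' → M → M'' → 0 a short exact sequence of finitely generated R-modules. Then cd(𝔞, M) = max{cd(𝔞, M'), cd(𝔞, M'')}. -/

import Mathlib

open TensorProduct CategoryTheory DirectSum

/-- The `n`-th local cohomology of `M` with support in `I`. -/
noncomputable def locCoh (R : Type) [CommRing R] (I : Ideal R) (n : ℕ)
    (M : Type) [AddCommGroup M] [Module R M] : ModuleCat R :=
  (localCohomology I n).obj (ModuleCat.of R M)

/-- The cohomological dimension `cd(I, M)`: the supremum, in `{-∞} ∪ ℕ ∪ {+∞}`, of the degrees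
in which the local cohomology of `M` with support in `I` is nonvanishing (`⊥ = -∞` if it
vanishes everywhere). -/
noncomputable def cohDim (R : Type) [CommRing R] (I : Ideal R)
    (M : Type) [AddCommGroup M] [Module R M] : WithBot ℕ∞ :=
  sSup {d : WithBot ℕ∞ | ∃ n : ℕ, d = (n : ℕ∞) ∧ Nontrivial (locCoh R I n M)}

/-- `grade(I, M)`: the infimum of the degrees in which the local cohomology of `M` with support
in `I` is nonvanishing, `+∞` if it vanishes everywhere (e.g. when `IM = M`). -/
noncomputable def gradeDim (R : Type) [CommRing R] (I : Ideal R)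
    (M : Type) [AddCommGroup M] [Module R M] : ℕ∞ :=
  sInf {d : ℕ∞ | ∃ n : ℕ, d = n ∧ Nontrivial (locCoh R I n M)}

/-- The finiteness dimension `f_I(M)`: the infimum of the degrees in which the local cohomology
of `M` with support in `I` is not a finitely generated module. -/
noncomputable def finDim (R : Type) [CommRing R] (I : Ideal R)
    (M : Type) [AddCommGroup M] [Module R M] : ℕ∞ :=
  sInf {d : ℕ∞ | ∃ n : ℕ, d = n ∧ ¬ Module.Finite R (locCoh R I n M)}

universe u v

section LocalCohomologyVanishing

open Opposite Limits Abelian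

section

theorem comp_square_of_iso {C : Type v} [Category.{u} C] {A A' B B' D D' : C} {a : A ⟶ A'}
    {p : A ⟶ B} {p' : A' ⟶ B'} {b : B ⟶ B'} {q : D ≅ B} {q' : D' ≅ B'} {d : D ⟶ D'}
    (h₁ : a ≫ p' = p ≫ b) (h₂ : q.hom ≫ b = d ≫ q'.hom) :
    a ≫ p' ≫ q'.inv = (p ≫ q.inv) ≫ d := by
  rw [← Category.assoc, Iso.comp_inv_eq, h₁, Category.assoc, Category.assoc, ← h₂,
    Iso.inv_hom_id_assoc]

variable {R : Type u} [CommRing R] {C : Type v} [Category.{u} C] [Abelian C] [Linear R C]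

variable (R) in
/-- The cochain map `Hom(K, Y) ⟶ Hom(K', Y)` induced by a chain map `K' ⟶ K`. -/
noncomputable def linearYonedaMap {K' K : ChainComplex C ℕ} (φ : K' ⟶ K) (Y : C) :
    K.linearYonedaObj R Y ⟶ K'.linearYonedaObj R Y :=
  (HomologicalComplex.unopFunctor _ _).map
    ((((linearYoneda R C).obj Y).rightOp.mapHomologicalComplex _).map φ).op

/-- The computation of `Ext` by projective resolutions is natural in the first argument. -/
theorem isoExt_naturality [EnoughProjectives C] {X X' : C} (P : ProjectiveResolution X)
    (P' : ProjectiveResolution X') (g : X' ⟶ X) (φ : ProjectiveResolution.Hom P' P g) (n : ℕ)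
    (Y : C) :
    ((_root_.Ext R C n).map g.op).app Y ≫ (P'.isoExt (R := R) n Y).hom =
      (P.isoExt n Y).hom ≫ HomologicalComplex.homologyMap (linearYonedaMap R φ.hom Y) n := by
  have hc : φ.hom.f 0 ≫ P.π.f 0 = P'.π.f 0 ≫ g := by
    rw [φ.hom_f_zero_comp_π_f_zero, ChainComplex.single₀_map_f_zero]
    rfl
  have h := congrArg Quiver.Hom.unop <| P'.isoLeftDerivedObj_inv_naturality g P φ.hom hc
    ((linearYoneda R C).obj Y).rightOp n
  have h' := congrArg Quiver.Hom.unop <|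
    HomologicalComplex.homologyOp_hom_naturality (linearYonedaMap R φ.hom Y) n
  exact comp_square_of_iso (q := ((P.complex.linearYonedaObj R Y).homologyOp n).unop)
    (q' := ((P'.complex.linearYonedaObj R Y).homologyOp n).unop) h h'

end

section

variable {R : Type u} [Ring R] (K : CochainComplex (ModuleCat.{u} R) ℕ) (n : ℕ)

theorem homologyπ_eq_zero_iff (z : K.cycles n) :
    K.homologyπ n z = 0 ↔ ∃ g : K.X ((ComplexShape.up ℕ).prev n), K.d _ n g = K.iCycles n z := by
  have h := (ShortComplex.moduleCat_exact_iff (ShortComplex.mk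
    (K.toCycles ((ComplexShape.up ℕ).prev n) n) (K.homologyπ n) (K.toCycles_comp_homologyπ _ _))).1
    (ShortComplex.exact_of_g_is_cokernel _ (K.homologyIsCokernel _ n rfl))
  have hi : Function.Injective (K.iCycles n) := (ModuleCat.mono_iff_injective _).1 inferInstance
  constructor
  · intro hz
    obtain ⟨g, hg⟩ := h z hz
    refine ⟨g, ?_⟩
    rw [← hg, ← K.toCycles_i]
    rfl
  · rintro ⟨g, hg⟩
    rw [← K.toCycles_i, ModuleCat.comp_apply] at hg
    rw [← hi hg, ← ModuleCat.comp_apply, K.toCycles_comp_homologyπ]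
    rfl

theorem exists_iCycles_eq (x : K.X n) (hx : K.d n (n + 1) x = 0) : ∃ z, K.iCycles n z = x :=
  (ShortComplex.moduleCat_exact_iff
    (ShortComplex.mk (K.iCycles n) (K.d n (n + 1)) (K.iCycles_d n (n + 1)))).1
    (ShortComplex.exact_of_f_is_kernel _ (K.cyclesIsKernel n (n + 1) (by simp))) x hx

end

section

variable {R : Type u} [CommRing R] {X Y : ModuleCat.{u} R}

theorem extMk_eq_zero_iff_exists (P : ProjectiveResolution X) (n : ℕ) (f : P.complex.X n ⟶ Y)
    (hf : P.complex.d (n + 1) n ≫ f = 0) :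
    P.extMk f (n + 1) rfl hf = 0 ↔
      ∃ g : P.complex.X ((ComplexShape.up ℕ).prev n) ⟶ Y, P.complex.d n _ ≫ g = f := by
  cases n with
  | succ n =>
    rw [P.extMk_eq_zero_iff f _ rfl hf n rfl,
      show (ComplexShape.up ℕ).prev (n + 1) = n from by simp]
  | zero =>
    rw [← P.extEquivCohomologyClass.apply_eq_iff_eq,
      ProjectiveResolution.extEquivCohomologyClass_extMk,
      ProjectiveResolution.extEquivCohomologyClass_zero,
      CochainComplex.HomComplex.CohomologyClass.mk_eq_zero_iff,
      CochainComplex.HomComplex.Cocycle.toSingleMk_mem_coboundaries_iff _ _ _ _ _ 1 (by lia)]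
    have h1 : IsZero (P.cochainComplex.X 1) := P.cochainComplex.isZero_of_isStrictlyLE 0 1
    have h2 : P.complex.d 0 ((ComplexShape.up ℕ).prev 0) = 0 :=
      P.complex.shape _ _ (by simp)
    simp only [h2, zero_comp, h1.eq_of_tgt (P.cochainComplex.d _ 1) 0]
    refine ⟨fun ⟨_, h⟩ ↦ ⟨0, ?_⟩, fun ⟨_, h⟩ ↦ ⟨0, ?_⟩⟩
    · rw [← cancel_epi (P.cochainComplexXIso (-(0 : ℕ)) 0 rfl).hom, comp_zero]
      simpa using h
    · simp [← h]

/-- Classes in the `Ext` defined by left derived functors and in the Yoneda `Ext` correspond to each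
other in such a way that the same maps `X' ⟶ X` annihilate them. -/
theorem exists_ext_map_eq_zero_iff (n : ℕ) :
    (∀ e : ((_root_.Ext R (ModuleCat R) n).obj (op X)).obj Y, ∃ e' : Abelian.Ext X Y n,
      ∀ (X' : ModuleCat R) (g : X' ⟶ X), ((_root_.Ext R _ n).map g.op).app Y e = 0 ↔
        (Ext.mk₀ g).comp e' (zero_add n) = 0) ∧
    (∀ e' : Abelian.Ext X Y n, ∃ e : ((_root_.Ext R (ModuleCat R) n).obj (op X)).obj Y,
      ∀ (X' : ModuleCat R) (g : X' ⟶ X), ((_root_.Ext R _ n).map g.op).app Y e = 0 ↔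
        (Ext.mk₀ g).comp e' (zero_add n) = 0) := by
  let P := projectiveResolution X
  let K := P.complex.linearYonedaObj R Y
  have key (e : ((_root_.Ext R (ModuleCat R) n).obj (op X)).obj Y) (z : K.cycles n)
      (f : P.complex.X n ⟶ Y) (hf : P.complex.d (n + 1) n ≫ f = 0) (hz : K.iCycles n z = f)
      (hez : (P.isoExt n Y).hom e = K.homologyπ n z) (X' : ModuleCat R) (g : X' ⟶ X) :
      ((_root_.Ext R _ n).map g.op).app Y e = 0 ↔
        (Ext.mk₀ g).comp (P.extMk f (n + 1) rfl hf) (zero_add n) = 0 := by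
    let P' := projectiveResolution X'
    let φ : ProjectiveResolution.Hom P' P g := ⟨ProjectiveResolution.lift g P' P, by
      rw [ProjectiveResolution.lift_commutes_zero, ChainComplex.single₀_map_f_zero]
      rfl⟩
    rw [ProjectiveResolution.mk₀_comp_extMk (φ := φ), extMk_eq_zero_iff_exists]
    have hinj : Function.Injective (P'.isoExt (R := R) n Y).hom :=
      (ModuleCat.mono_iff_injective _).1 inferInstance
    rw [← map_eq_zero_iff (P'.isoExt (R := R) n Y).hom.hom hinj]
    let ψ := linearYonedaMap R φ.hom Y
    have h1 : (P'.isoExt n Y).hom (((_root_.Ext R (ModuleCat R) n).map g.op).app Y e) =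
        HomologicalComplex.homologyMap ψ n ((P.isoExt n Y).hom e) :=
      congr($(isoExt_naturality (R := R) P P' g φ n Y) e)
    have h2 : HomologicalComplex.homologyMap ψ n (K.homologyπ n z) =
        (P'.complex.linearYonedaObj R Y).homologyπ n (HomologicalComplex.cyclesMap ψ n z) :=
      congr($(HomologicalComplex.homologyπ_naturality ψ n) z)
    have h3 : (P'.complex.linearYonedaObj R Y).iCycles n (HomologicalComplex.cyclesMap ψ n z) =
        ψ.f n (K.iCycles n z) :=
      congr($(HomologicalComplex.cyclesMap_i ψ n) z)
    have h4 := homologyπ_eq_zero_iff (R := R) (P'.complex.linearYonedaObj R Y) n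
      (HomologicalComplex.cyclesMap ψ n z)
    rw [h3, hz, ← h2, ← hez, ← h1] at h4
    exact h4
  constructor
  · intro e
    obtain ⟨z, hz⟩ := (ModuleCat.epi_iff_surjective (K.homologyπ n)).1 inferInstance
      ((P.isoExt n Y).hom e)
    have hf : K.d n (n + 1) (K.iCycles n z) = 0 := by
      rw [← ModuleCat.comp_apply, K.iCycles_d]
      rfl
    exact ⟨_, key e z _ hf rfl hz.symm⟩
  · intro e'
    obtain ⟨f, hf, rfl⟩ := P.extMk_surjective e' (n + 1) rfl
    obtain ⟨z, hz⟩ := exists_iCycles_eq K n f hf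
    refine ⟨(P.isoExt n Y).inv (K.homologyπ n z), key _ z f hf hz ?_⟩
    rw [← ModuleCat.comp_apply, Iso.inv_hom_id]
    rfl

end

section

variable {R : Type u} [CommRing R]

/-- The canonical projection `R ⧸ I ^ s ⟶ R ⧸ I ^ t` for `t ≤ s`. -/
def powQuotMap (I : Ideal R) {t s : ℕ} (h : t ≤ s) :
    ModuleCat.of R (R ⧸ I ^ s) ⟶ ModuleCat.of R (R ⧸ I ^ t) :=
  ModuleCat.ofHom (Submodule.mapQ _ _ LinearMap.id (Ideal.pow_le_pow_right h))

/-- The vanishing of `H^n_I(N)`, expressed on Yoneda `Ext` classes. -/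
def LocCohVanish (I : Ideal R) (n : ℕ) (N : Type u) [AddCommGroup N] [Module R N] : Prop :=
  ∀ (t : ℕ) (e : Ext (ModuleCat.of R (R ⧸ I ^ t)) (ModuleCat.of R N) n),
    ∃ (s : ℕ) (h : t ≤ s), (Ext.mk₀ (powQuotMap I h)).comp e (zero_add n) = 0

theorem subsingleton_colimit_iff {J : Type} [SmallCategory J] [IsFiltered J]
    (F : J ⥤ ModuleCat.{u} R) {c : Cocone F} (hc : IsColimit c) :
    Subsingleton c.pt ↔ ∀ (j : J) (x : F.obj j), ∃ (k : J) (i : j ⟶ k), F.map i x = 0 := by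
  have : PreservesFilteredColimitsOfSize.{0, 0} (forget (ModuleCat.{u} R)) :=
    preservesFilteredColimitsOfSize_shrink.{0, u, 0, u} _
  have : PreservesColimit F (forget (ModuleCat.{u} R)) := inferInstance
  constructor
  · intro h j x
    obtain ⟨k, i, i', hk⟩ := Concrete.isColimit_exists_of_rep_eq F hc x (0 : F.obj j)
      (@Subsingleton.elim c.pt h _ _)
    exact ⟨k, i, by rw [hk, map_zero]⟩
  · intro h
    refine subsingleton_of_forall_eq 0 fun y ↦ ?_
    obtain ⟨j, x, rfl⟩ := Concrete.isColimit_exists_rep F hc y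
    obtain ⟨k, i, hk⟩ := h j x
    rw [← c.w i, ModuleCat.comp_apply, hk, map_zero]

theorem subsingleton_localCohomology_iff (I : Ideal R) (n : ℕ) (N : Type u) [AddCommGroup N]
    [Module R N] :
    Subsingleton ((localCohomology I n).obj (ModuleCat.of R N)) ↔ LocCohVanish I n N := by
  let F := localCohomology.diagram (localCohomology.idealPowersDiagram I) n
  refine (subsingleton_colimit_iff (F ⋙ (evaluation _ _).obj (ModuleCat.of R N))
    (isColimitOfPreserves ((evaluation _ _).obj (ModuleCat.of R N)) (colimit.isColimit F))).trans ?_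
  constructor
  · intro h t e
    obtain ⟨x, hx⟩ := (exists_ext_map_eq_zero_iff n).2 e
    obtain ⟨k, i, hk⟩ := h (op (op t)) x
    exact ⟨k.unop.unop, i.unop.unop.le, (hx _ _).1 hk⟩
  · intro h j x
    obtain ⟨e, he⟩ := (exists_ext_map_eq_zero_iff n).1 x
    obtain ⟨s, hs, hse⟩ := h j.unop.unop e
    exact ⟨op (op s), (homOfLE hs).op.op, (he _ (powQuotMap I hs)).2 hse⟩

end

section

variable {R : Type u} [CommRing R] {I : Ideal R} {n : ℕ} {A B C : Type u} [AddCommGroup A]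
  [Module R A] [AddCommGroup B] [Module R B] [AddCommGroup C] [Module R C]

theorem powQuotMap_comp {t s r : ℕ} (h : t ≤ s) (h' : s ≤ r) :
    powQuotMap I h' ≫ powQuotMap I h = powQuotMap I (h.trans h') := by
  ext
  rfl

theorem powQuotMap_comp_ext {t s r : ℕ} (h : t ≤ s) (h' : s ≤ r) {Y : ModuleCat.{u} R}
    (e : Ext (ModuleCat.of R (R ⧸ I ^ t)) Y n) :
    (Ext.mk₀ (powQuotMap I h')).comp ((Ext.mk₀ (powQuotMap I h)).comp e (zero_add n)) (zero_add n) =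
      (Ext.mk₀ (powQuotMap I (h.trans h'))).comp e (zero_add n) := by
  rw [Ext.mk₀_comp_mk₀_assoc, powQuotMap_comp]

variable {f : A →ₗ[R] B} {g : B →ₗ[R] C}

theorem LocCohVanish.mid (h : Function.Exact f g) (hf : Function.Injective f)
    (hg : Function.Surjective g) (hA : LocCohVanish I n A) (hC : LocCohVanish I n C) :
    LocCohVanish I n B := by
  have hS := ModuleCat.shortComplex_shortExact
    (ModuleCat.shortComplexOfCompEqZero f g h.linearMap_comp_eq_zero) h hf hg
  intro t e
  obtain ⟨s, hs, h1⟩ := hC t (e.comp (Ext.mk₀ (ModuleCat.ofHom g)) (add_zero n))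
  rw [← Ext.comp_assoc_of_third_deg_zero] at h1
  obtain ⟨e', he'⟩ := Ext.covariant_sequence_exact₂ _ hS _ h1
  obtain ⟨r, hr, h2⟩ := hA s e'
  refine ⟨r, hs.trans hr, ?_⟩
  rw [← powQuotMap_comp_ext hs hr, ← he', ← Ext.comp_assoc_of_third_deg_zero, h2, Ext.zero_comp]

theorem LocCohVanish.right (h : Function.Exact f g) (hf : Function.Injective f)
    (hg : Function.Surjective g) (hB : LocCohVanish I n B) (hA : LocCohVanish I (n + 1) A) :
    LocCohVanish I n C := by
  have hS := ModuleCat.shortComplex_shortExact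
    (ModuleCat.shortComplexOfCompEqZero f g h.linearMap_comp_eq_zero) h hf hg
  intro t e
  obtain ⟨s, hs, h1⟩ := hA t (e.comp hS.extClass rfl)
  rw [← Ext.comp_assoc _ _ _ (zero_add n) _ (by omega)] at h1
  obtain ⟨e', he'⟩ := Ext.covariant_sequence_exact₃ _ hS _ _ h1
  obtain ⟨r, hr, h2⟩ := hB s e'
  refine ⟨r, hs.trans hr, ?_⟩
  rw [← powQuotMap_comp_ext hs hr, ← he', ← Ext.comp_assoc_of_third_deg_zero, h2, Ext.zero_comp]

theorem LocCohVanish.left (h : Function.Exact f g) (hf : Function.Injective f)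
    (hg : Function.Surjective g) (hC : LocCohVanish I n C) (hB : LocCohVanish I (n + 1) B) :
    LocCohVanish I (n + 1) A := by
  have hS := ModuleCat.shortComplex_shortExact
    (ModuleCat.shortComplexOfCompEqZero f g h.linearMap_comp_eq_zero) h hf hg
  intro t e
  obtain ⟨s, hs, h1⟩ := hB t (e.comp (Ext.mk₀ (ModuleCat.ofHom f)) (add_zero (n + 1)))
  rw [← Ext.comp_assoc_of_third_deg_zero] at h1
  obtain ⟨e', he'⟩ := Ext.covariant_sequence_exact₁ _ hS _ h1 rfl
  obtain ⟨r, hr, h2⟩ := hC s e'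
  refine ⟨r, hs.trans hr, ?_⟩
  rw [← powQuotMap_comp_ext hs hr, ← he', ← Ext.comp_assoc _ _ _ (zero_add n) _ (by omega), h2,
    Ext.zero_comp]

theorem pow_smul_ext_eq_zero {x : R} (hx : x ∈ I) {t : ℕ} {Y : ModuleCat.{u} R}
    (e : Ext (ModuleCat.of R (R ⧸ I ^ t)) Y n) : x ^ t • e = 0 := by
  have h : x ^ t • 𝟙 (ModuleCat.of R (R ⧸ I ^ t)) = 0 := by
    ext
    change x ^ t • (1 : R ⧸ I ^ t) = 0
    rw [← Ideal.Quotient.eq_zero_iff_mem.2 (Ideal.pow_mem_pow hx t), Algebra.smul_def, mul_one]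
    rfl
  rw [← Ext.mk₀_id_comp e, ← Ext.smul_comp, ← Ext.mk₀_smul, h, Ext.mk₀_zero, Ext.zero_comp]

theorem LocCohVanish.of_smul_injective {g : A →ₗ[R] C} {x : R} (hx : x ∈ I)
    (hxA : Function.Injective fun a : A ↦ x • a) (hg : Function.Surjective g)
    (h : Function.Exact (fun a : A ↦ x • a) g) (hC : LocCohVanish I n C) :
    LocCohVanish I (n + 1) A := by
  let f : A →ₗ[R] A := LinearMap.lsmul R A x
  have h : Function.Exact f g := h
  have hS := ModuleCat.shortComplex_shortExact
    (ModuleCat.shortComplexOfCompEqZero f g h.linearMap_comp_eq_zero) h hxA hg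
  have key (k : ℕ) : ∀ (t : ℕ) (e : Ext (ModuleCat.of R (R ⧸ I ^ t)) (ModuleCat.of R A) (n + 1)),
      x ^ k • e = 0 → ∃ (s : ℕ) (hs : t ≤ s),
        (Ext.mk₀ (powQuotMap I hs)).comp e (zero_add (n + 1)) = 0 := by
    induction k with
    | zero =>
      intro t e he
      rw [pow_zero, one_smul] at he
      exact ⟨t, le_rfl, by rw [he, Ext.comp_zero]⟩
    | succ k ih =>
      intro t e he
      rw [pow_succ, mul_smul] at he
      obtain ⟨s, hs, h1⟩ := ih t _ he
      have hf : x • 𝟙 (ModuleCat.of R A) = ModuleCat.ofHom f := rfl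
      rw [Ext.comp_smul, Ext.smul_eq_comp_mk₀, hf] at h1
      obtain ⟨e', he'⟩ := Ext.covariant_sequence_exact₁ _ hS _ h1 rfl
      obtain ⟨r, hr, h2⟩ := hC s e'
      refine ⟨r, hs.trans hr, ?_⟩
      rw [← powQuotMap_comp_ext hs hr, ← he', ← Ext.comp_assoc _ _ _ (zero_add n) _ (by omega), h2,
        Ext.zero_comp]
  exact fun t e ↦ key t t e (pow_smul_ext_eq_zero hx e)

theorem LocCohVanish.of_equiv (e : A ≃ₗ[R] B) (hA : LocCohVanish I n A) : LocCohVanish I n B := by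
  intro t x
  obtain ⟨s, hs, h⟩ := hA t (x.comp (Ext.mk₀ (ModuleCat.ofHom e.symm.toLinearMap)) (add_zero n))
  refine ⟨s, hs, ?_⟩
  have := congr(($h).comp (Ext.mk₀ (ModuleCat.ofHom e.toLinearMap)) (add_zero n))
  rw [← Ext.comp_assoc_of_third_deg_zero, Ext.zero_comp, Ext.comp_assoc_of_third_deg_zero,
    Ext.mk₀_comp_mk₀] at this
  have h1 : ModuleCat.ofHom e.symm.toLinearMap ≫ ModuleCat.ofHom e.toLinearMap = 𝟙 _ := by
    ext
    simp
  rwa [h1, Ext.comp_mk₀_id] at this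

end

section

variable {R : Type u} [CommRing R] (I : Ideal R) (N : Type u) [AddCommGroup N] [Module R N]

/-- The submodule of elements killed by some power of the ideal `I`. -/
def powTorsion : Submodule R N where
  carrier := {y | ∃ k : ℕ, ∀ a ∈ I ^ k, a • y = 0}
  zero_mem' := ⟨0, fun a _ ↦ smul_zero a⟩
  add_mem' := by
    rintro x y ⟨k, hk⟩ ⟨l, hl⟩
    refine ⟨k + l, fun a ha ↦ ?_⟩
    rw [smul_add, hk a (Ideal.pow_le_pow_right (by omega) ha),
      hl a (Ideal.pow_le_pow_right (by omega) ha), add_zero]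
  smul_mem' := by
    rintro r y ⟨k, hk⟩
    exact ⟨k, fun a ha ↦ by rw [smul_comm, hk a ha, smul_zero]⟩

variable {I N}

theorem exists_pow_smul_eq_zero_of_finite [Module.Finite R N] (h : powTorsion I N = ⊤) :
    ∃ k : ℕ, ∀ a ∈ I ^ k, ∀ y : N, a • y = 0 := by
  obtain ⟨S, hS⟩ := Module.Finite.fg_top (R := R) (M := N)
  have h' (y : N) : ∃ k : ℕ, ∀ a ∈ I ^ k, a • y = 0 := by
    have : y ∈ powTorsion I N := h ▸ Submodule.mem_top
    exact this
  choose k hk using h'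
  refine ⟨S.sup k, fun a ha y ↦ ?_⟩
  have : Submodule.span R (S : Set N) ≤ LinearMap.ker (LinearMap.lsmul R N a) :=
    Submodule.span_le.2 fun z hz ↦ hk z a (Ideal.pow_le_pow_right (Finset.le_sup hz) ha)
  exact this (hS ▸ Submodule.mem_top)

variable [IsNoetherianRing R]

variable (I N) in
/-- The `I`-power torsion of an injective module over a Noetherian ring is injective. -/
theorem injective_powTorsion [Module.Injective R N] : Module.Injective R (powTorsion I N) := by
  refine Module.Baer.injective fun J g ↦ ?_
  obtain ⟨k, hk⟩ := exists_pow_smul_eq_zero_of_finite (I := I) (N := LinearMap.range g) (by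
    refine eq_top_iff.2 fun ⟨y, _⟩ _ ↦ ?_
    obtain ⟨l, hl⟩ := y.2
    exact ⟨l, fun a ha ↦ Subtype.ext (Subtype.ext (hl a ha))⟩)
  obtain ⟨m, hm⟩ := Ideal.exists_pow_inf_eq_pow_smul I (J : Submodule R R)
  let ψ : J →ₗ[R] R ⧸ I ^ (m + k) := (Submodule.mkQ _).comp (Submodule.subtype J)
  let g₁ : J →ₗ[R] N := (Submodule.subtype _).comp g
  have hψ : LinearMap.ker ψ ≤ LinearMap.ker g₁ := by
    intro y hy
    have hy' : (y : R) ∈ I ^ (m + k) := by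
      exact Ideal.Quotient.eq_zero_iff_mem.1 hy
    have h1 : (y : R) ∈ (I ^ k • J : Submodule R R) := by
      have h2 : (y : R) ∈ (I ^ (m + k) • ⊤ ⊓ J : Submodule R R) := ⟨by simpa using hy', y.2⟩
      rw [hm (m + k) (by omega), Nat.add_sub_cancel_left] at h2
      exact Submodule.smul_mono le_rfl inf_le_right h2
    have h3 : I ^ k • (⊤ : Submodule R J) ≤ LinearMap.ker g₁ := by
      refine Submodule.smul_le.2 fun a ha z _ ↦ ?_
      have := hk a ha ⟨g z, z, rfl⟩
      rw [LinearMap.mem_ker, map_smul]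
      exact congrArg (fun w ↦ ((w : powTorsion I N) : N)) (congrArg Subtype.val this)
    have h4 : (I ^ k • (⊤ : Submodule R J)).map (Submodule.subtype J) = I ^ k • J := by
      rw [Submodule.map_smul'', Submodule.map_top, Submodule.range_subtype]
    rw [← h4] at h1
    obtain ⟨z, hz, hzy⟩ := h1
    obtain rfl : z = y := Subtype.ext hzy
    exact h3 hz
  obtain ⟨h, hh⟩ := Module.Injective.out ((LinearMap.ker ψ).liftQ ψ le_rfl)
    (LinearMap.ker_eq_bot.1 (Submodule.ker_liftQ_eq_bot _ _ _ le_rfl))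
    ((LinearMap.ker ψ).liftQ g₁ hψ)
  refine ⟨LinearMap.codRestrict _ (h.comp (Submodule.mkQ _)) fun r ↦ ⟨m + k, fun a ha ↦ ?_⟩,
    fun x hx ↦ Subtype.ext (hh (Submodule.Quotient.mk ⟨x, hx⟩))⟩
  rw [LinearMap.comp_apply, ← map_smul, ← map_smul, Submodule.mkQ_apply,
    (Submodule.Quotient.mk_eq_zero _).2 (by simpa using Ideal.mul_mem_right r _ ha), map_zero]

/-- The higher local cohomology of `I`-power torsion modules vanishes. -/
theorem LocCohVanish.of_powTorsion_eq_top (n : ℕ) : ∀ (N : Type u) [AddCommGroup N] [Module R N],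
    powTorsion I N = ⊤ → LocCohVanish I (n + 1) N := by
  induction n with
  | zero => ?_
  | succ n ih => ?_
  all_goals
    intro N _ _ hN
    let E := Injective.under (ModuleCat.of R N)
    have hE : Injective (ModuleCat.of R E) := Injective.injective_under (ModuleCat.of R N)
    have : Module.Injective R E := Module.injective_module_of_injective_object R E
    let E' := powTorsion I E
    have := injective_powTorsion I E
    have : Injective (ModuleCat.of R E') := Module.injective_object_of_injective_module R E'
    let ι : N →ₗ[R] E := (Injective.ι (ModuleCat.of R N)).hom
    have hι : Function.Injective ι := (ModuleCat.mono_iff_injective _).1 inferInstance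
    let j : N →ₗ[R] E' := ι.codRestrict _ fun y ↦ by
      obtain ⟨k, hk⟩ : y ∈ powTorsion I N := hN ▸ Submodule.mem_top
      exact ⟨k, fun a ha ↦ by rw [← map_smul, hk a ha, map_zero]⟩
    have hj : Function.Injective j := fun x y h ↦ hι (congrArg Subtype.val h)
    let g := (LinearMap.range j).mkQ
    have hg : Function.Surjective g := Submodule.mkQ_surjective _
    have hjg : Function.Exact j g := LinearMap.exact_map_mkQ_range j
  · have hS := ModuleCat.shortComplex_shortExact
      (ModuleCat.shortComplexOfCompEqZero j g hjg.linearMap_comp_eq_zero) hjg hj hg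
    intro t e
    obtain ⟨c, hc⟩ := Ext.covariant_sequence_exact₁ _ hS e
      (Ext.eq_zero_of_injective (I := ModuleCat.of R E') _) rfl
    obtain ⟨φ, rfl⟩ := (Ext.mk₀_bijective _ _).2 c
    obtain ⟨y, hy⟩ := hg (φ (1 : R ⧸ I ^ t))
    obtain ⟨k, hk⟩ := y.2
    refine ⟨t + k, by omega, ?_⟩
    let χ : R ⧸ I ^ (t + k) →ₗ[R] E' := (I ^ (t + k)).liftQ (LinearMap.toSpanSingleton R E' y)
      fun a ha ↦ Subtype.ext (hk a (Ideal.pow_le_pow_right (by omega) ha))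
    have h1 : powQuotMap I (show t ≤ t + k by omega) ≫ φ =
        ModuleCat.ofHom χ ≫ ModuleCat.ofHom g := by
      ext
      change φ (1 : R ⧸ I ^ t) = g ((1 : R) • y)
      rw [one_smul, hy]
    rw [← hc, Ext.mk₀_comp_mk₀_assoc, h1, ← Ext.mk₀_comp_mk₀_assoc]
    erw [hS.comp_extClass]
    rw [Ext.comp_zero]
  · refine LocCohVanish.left hjg hj hg (ih _ ?_) fun t e ↦ ⟨t, le_rfl, ?_⟩
    · refine eq_top_iff.2 fun c _ ↦ ?_
      obtain ⟨⟨y, k, hk⟩, rfl⟩ := hg c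
      exact ⟨k, fun a ha ↦ by
        rw [← map_smul, show a • (⟨y, k, hk⟩ : E') = 0 from Subtype.ext (hk a ha), map_zero]⟩
    · rw [Ext.eq_zero_of_injective e, Ext.comp_zero]

end

section

variable {R : Type u} [CommRing R] {I : Ideal R} {n : ℕ} {N : Type u} [AddCommGroup N] [Module R N]

theorem LocCohVanish.of_submodule {A : Submodule R N} (h₁ : LocCohVanish I n A)
    (h₂ : LocCohVanish I n (N ⧸ A)) : LocCohVanish I n N :=
  LocCohVanish.mid (LinearMap.exact_subtype_mkQ A) A.injective_subtype A.mkQ_surjective h₁ h₂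

theorem LocCohVanish.of_pow_smul_eq_zero [IsNoetherianRing R] {K : Ideal R} {x : R}
    (h : ∀ (N : Type u) [AddCommGroup N] [Module R N] [Module.Finite R N],
      (∀ a ∈ K, ∀ y : N, a • y = 0) → (∀ y : N, x • y = 0) → LocCohVanish I n N)
    (k : ℕ) : ∀ (N : Type u) [AddCommGroup N] [Module R N] [Module.Finite R N],
      (∀ a ∈ K, ∀ y : N, a • y = 0) → (∀ y : N, x ^ k • y = 0) → LocCohVanish I n N := by
  induction k with
  | zero =>
    intro N _ _ _ hK hx
    exact h N hK fun y ↦ by rw [← one_smul R y, ← pow_zero x, hx, smul_zero]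
  | succ k ih =>
    intro N _ _ _ hK hx
    refine LocCohVanish.of_submodule (A := LinearMap.range (LinearMap.lsmul R N x)) (ih _ ?_ ?_)
      (h _ ?_ ?_)
    · exact fun a ha y ↦ Subtype.ext (hK a ha y)
    · rintro ⟨_, y, rfl⟩
      refine Subtype.ext ?_
      change x ^ k • x • y = 0
      rw [← mul_smul, ← pow_succ, hx]
    · intro a ha y
      obtain ⟨y, rfl⟩ := Submodule.mkQ_surjective _ y
      rw [← map_smul, hK a ha, map_zero]
    · intro y
      obtain ⟨y, rfl⟩ := Submodule.mkQ_surjective _ y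
      rw [← map_smul]
      exact (Submodule.Quotient.mk_eq_zero _).2 ⟨y, rfl⟩

theorem LocCohVanish.succ_of_sup_span_singleton [IsNoetherianRing R] {K : Ideal R} {x : R}
    (hx : x ∈ I)
    (h : ∀ m, n ≤ m → ∀ (N : Type u) [AddCommGroup N] [Module R N] [Module.Finite R N],
      (∀ a ∈ K, ∀ y : N, a • y = 0) → (∀ y : N, x • y = 0) → LocCohVanish I m N)
    (N : Type u) [AddCommGroup N] [Module R N] [Module.Finite R N]
    (hN : ∀ a ∈ K, ∀ y : N, a • y = 0) : LocCohVanish I (n + 1) N := by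
  let T := powTorsion (Ideal.span {x}) N
  have hT : powTorsion (Ideal.span {x}) T = ⊤ :=
    eq_top_iff.2 fun ⟨y, k, hk⟩ _ ↦ ⟨k, fun a ha ↦ Subtype.ext (hk a ha)⟩
  obtain ⟨k, hk⟩ := exists_pow_smul_eq_zero_of_finite hT
  refine LocCohVanish.of_submodule (A := T)
    (LocCohVanish.of_pow_smul_eq_zero (h (n + 1) (by omega)) k T
      (fun a ha y ↦ Subtype.ext (hN a ha y))
      (hk _ (Ideal.pow_mem_pow (Ideal.mem_span_singleton_self x) k))) ?_
  refine LocCohVanish.of_smul_injective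
    (C := (N ⧸ T) ⧸ LinearMap.range (LinearMap.lsmul R (N ⧸ T) x)) (g := Submodule.mkQ _) hx ?_
    (Submodule.mkQ_surjective _)
    (LinearMap.exact_map_mkQ_range (LinearMap.lsmul R (N ⧸ T) x)) (h n le_rfl _ ?_ ?_)
  · refine (injective_iff_map_eq_zero (LinearMap.lsmul R (N ⧸ T) x)).2 fun y hy ↦ ?_
    obtain ⟨y, rfl⟩ := Submodule.mkQ_surjective _ y
    rw [LinearMap.lsmul_apply, ← map_smul] at hy
    obtain ⟨l, hl⟩ := (Submodule.Quotient.mk_eq_zero T).1 hy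
    refine (Submodule.Quotient.mk_eq_zero T).2 ⟨l + 1, fun a ha ↦ ?_⟩
    rw [Ideal.span_singleton_pow, Ideal.mem_span_singleton'] at ha
    obtain ⟨b, rfl⟩ := ha
    rw [pow_succ, ← mul_assoc, mul_smul]
    exact hl _ (Ideal.mul_mem_left _ _ (Ideal.pow_mem_pow (Ideal.mem_span_singleton_self x) l))
  · intro a ha y
    obtain ⟨y, rfl⟩ := Submodule.mkQ_surjective _ y
    obtain ⟨y, rfl⟩ := Submodule.mkQ_surjective _ y
    rw [← map_smul, ← map_smul, hN a ha, map_zero, map_zero]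
  · intro y
    obtain ⟨y, rfl⟩ := Submodule.mkQ_surjective _ y
    rw [← map_smul]
    exact (Submodule.Quotient.mk_eq_zero _).2 ⟨y, rfl⟩

/-- Local cohomology of finitely generated modules vanishes in all large degrees. -/
theorem exists_locCohVanish_of_le [IsNoetherianRing R] (I : Ideal R) :
    ∃ B : ℕ, ∀ m, B ≤ m → ∀ (N : Type u) [AddCommGroup N] [Module R N] [Module.Finite R N],
      LocCohVanish I m N := by
  have key (S : Finset R) (hS : (S : Set R) ⊆ I) (B : ℕ)
      (hB : ∀ m, B ≤ m → ∀ (N : Type u) [AddCommGroup N] [Module R N] [Module.Finite R N],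
        (∀ a ∈ Ideal.span (S : Set R), ∀ y : N, a • y = 0) → LocCohVanish I m N) :
      ∃ B : ℕ, ∀ m, B ≤ m → ∀ (N : Type u) [AddCommGroup N] [Module R N] [Module.Finite R N],
        LocCohVanish I m N := by
    classical
    induction S using Finset.induction_on generalizing B with
    | empty =>
      refine ⟨B, fun m hm N _ _ _ ↦ hB m hm N fun a ha y ↦ ?_⟩
      obtain rfl : a = 0 := by simpa using ha
      exact zero_smul _ _
    | insert x S _ ih =>
      rw [Finset.coe_insert, Set.insert_subset_iff] at hS
      refine ih hS.2 (B + 1) fun m hm N _ _ _ hN ↦ ?_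
      obtain ⟨m, rfl⟩ : ∃ l, m = l + 1 := ⟨m - 1, by omega⟩
      refine LocCohVanish.succ_of_sup_span_singleton hS.1 (fun l hl N _ _ _ hK hx ↦
        hB l (by omega) N fun a ha y ↦ ?_) N hN
      rw [Finset.coe_insert, Ideal.mem_span_insert] at ha
      obtain ⟨b, z, hz, rfl⟩ := ha
      rw [add_smul, mul_smul, hx, smul_zero, hK z hz, add_zero]
  obtain ⟨S, hS⟩ := (isNoetherianRing_iff_ideal_fg R).1 ‹_› I
  refine key S (hS ▸ Ideal.subset_span) 1 fun m hm N _ _ _ hN ↦ ?_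
  obtain ⟨m, rfl⟩ : ∃ l, m = l + 1 := ⟨m - 1, by omega⟩
  refine LocCohVanish.of_powTorsion_eq_top m N (eq_top_iff.2 fun y _ ↦ ⟨1, fun a ha ↦ ?_⟩)
  exact hN a (hS.symm ▸ pow_one I ▸ ha) y

end

section

variable {R : Type u} [CommRing R] {I : Ideal R} {n : ℕ}

theorem LocCohVanish.of_subsingleton (N : Type u) [AddCommGroup N] [Module R N] [Subsingleton N] :
    LocCohVanish I n N := by
  intro t e
  have h : 𝟙 (ModuleCat.of R N) = 0 := by
    ext y
    exact Subsingleton.elim _ _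
  exact ⟨t, le_rfl, by rw [← Ext.comp_mk₀_id e, h, Ext.mk₀_zero, Ext.comp_zero, Ext.comp_zero]⟩

/-- A prime ideal `p` containing the annihilator of a finite module `M` admits a nonzero map
`M → R ⧸ p`. -/
theorem exists_linearMap_quotient_prime_ne_zero [IsNoetherianRing R] (M : Type u)
    [AddCommGroup M] [Module R M] [Module.Finite R M] (p : Ideal R) [p.IsPrime]
    (hp : Module.annihilator R M ≤ p) :
    ∃ φ : M →ₗ[R] R ⧸ p, φ ≠ 0 := by
  by_contra! h
  obtain ⟨r, hr, hreg⟩ := IsSMulRegular.subsingleton_linearMap_iff.1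
    (subsingleton_of_forall_eq 0 h)
  have h1 : r • (1 : R ⧸ p) = r • 0 := by
    rw [smul_zero, Algebra.smul_def, mul_one]
    exact Ideal.Quotient.eq_zero_iff_mem.2 (hp hr)
  exact one_ne_zero (hreg h1)

section RightExact

variable [IsNoetherianRing R] {𝔟 : Ideal R}
    (h : ∀ (N : Type u) [AddCommGroup N] [Module R N] [Module.Finite R N],
      (∀ a ∈ 𝔟, ∀ y : N, a • y = 0) → LocCohVanish I (n + 1) N)
include h

theorem LocCohVanish.of_surjective {N N' : Type u} [AddCommGroup N] [Module R N] [Module.Finite R N]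
    [AddCommGroup N'] [Module R N'] (hN : ∀ a ∈ 𝔟, ∀ y : N, a • y = 0) {f : N →ₗ[R] N'}
    (hf : Function.Surjective f) (hv : LocCohVanish I n N) : LocCohVanish I n N' :=
  LocCohVanish.right (LinearMap.exact_subtype_ker_map f) (Submodule.injective_subtype _) hf hv
    (h _ fun a ha y ↦ Subtype.ext (hN a ha y))

theorem LocCohVanish.of_quotient {J : Ideal R} (hJ : 𝔟 ≤ J) (hv : LocCohVanish I n (R ⧸ J))
    (N : Type u) [AddCommGroup N] [Module R N] [Module.Finite R N]
    (hN : ∀ a ∈ J, ∀ y : N, a • y = 0) : LocCohVanish I n N := by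
  have hb : ∀ a ∈ 𝔟, ∀ y : N, a • y = 0 := fun a ha ↦ hN a (hJ ha)
  have hbJ : ∀ a ∈ 𝔟, ∀ y : R ⧸ J, a • y = 0 := by
    intro a ha y
    rw [Algebra.smul_def]
    exact mul_eq_zero_of_left (Ideal.Quotient.eq_zero_iff_mem.2 (hJ ha)) y
  have key (A : Submodule R N) (hA : A.FG) : LocCohVanish I n A := by
    induction A, hA using Submodule.fg_induction with
    | singleton x =>
      let f : R ⧸ J →ₗ[R] N := J.liftQ (LinearMap.toSpanSingleton R N x) fun a ha ↦ hN a ha x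
      have hf : LinearMap.range f = Submodule.span R {x} :=
        (Submodule.range_liftQ _ _ _).trans (LinearMap.range_toSpanSingleton x)
      rw [← hf]
      exact LocCohVanish.of_surjective h hbJ f.surjective_rangeRestrict hv
    | sup A B _ _ hA hB =>
      rw [Submodule.sup_eq_range]
      refine LocCohVanish.of_surjective h (N := A × B) ?_ (LinearMap.surjective_rangeRestrict _) ?_
      · exact fun a ha y ↦ Prod.ext (Subtype.ext (hb a ha y.1)) (Subtype.ext (hb a ha y.2))
      · exact LocCohVanish.mid Function.Exact.inl_snd LinearMap.inl_injective
          LinearMap.snd_surjective hA hB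
  exact LocCohVanish.of_equiv Submodule.topEquiv (key ⊤ (Module.Finite.fg_top))

/-- If `H^n_I` is right exact on finite modules killed by the annihilator of `M` and vanishes on
`M`, then it vanishes on all quotients of `R` by ideals containing this annihilator. -/
theorem locCohVanish_quotient_of_annihilator_le {M : Type u} [AddCommGroup M] [Module R M]
    [Module.Finite R M] (hM : Module.annihilator R M = 𝔟) (hv : LocCohVanish I n M) (J : Ideal R)
    (hJ : 𝔟 ≤ J) : LocCohVanish I n (R ⧸ J) := by
  induction J using IsNoetherian.induction (R := R) (M := R) with
  | _ J ih =>
  have key (A : Submodule R (R ⧸ J)) (a : R) (ha : a ∉ J) (haA : Submodule.Quotient.mk a ∈ A)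
      (hA : LocCohVanish I n A) : LocCohVanish I n (R ⧸ J) := by
    refine LocCohVanish.of_submodule hA ?_
    have hlt : J < J ⊔ Ideal.span {a} := left_lt_sup.2 fun h ↦
      ha (h (Ideal.mem_span_singleton_self a))
    refine LocCohVanish.of_quotient h (hJ.trans hlt.le) (ih _ hlt (hJ.trans hlt.le)) _
      fun c hc y ↦ ?_
    obtain ⟨y, rfl⟩ := Submodule.mkQ_surjective _ y
    obtain ⟨y, rfl⟩ := Submodule.mkQ_surjective _ y
    rw [← map_smul]
    refine (Submodule.Quotient.mk_eq_zero _).2 ?_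
    obtain ⟨d, hd, z, hz, rfl⟩ := Submodule.mem_sup.1 hc
    obtain ⟨w, rfl⟩ := Ideal.mem_span_singleton'.1 hz
    have h1 : (d + w * a) • (Submodule.mkQ J) y = (y * w) • Submodule.Quotient.mk (p := J) a := by
      rw [← map_smul]
      refine (Submodule.Quotient.eq J).2 ?_
      have : (d + w * a) • y - (y * w) • a = y * d := by simp only [smul_eq_mul]; ring
      erw [this]
      exact Ideal.mul_mem_left _ _ hd
    rw [h1]
    exact A.smul_mem _ haA
  by_cases hp : Ideal.IsPrime J
  · obtain ⟨φ, hφ⟩ := exists_linearMap_quotient_prime_ne_zero M J (hM.trans_le hJ)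
    obtain ⟨y, hy⟩ : ∃ y, φ y ≠ 0 := by
      by_contra! h0
      exact hφ (LinearMap.ext h0)
    obtain ⟨a, ha⟩ := Submodule.Quotient.mk_surjective _ (φ y)
    refine key (LinearMap.range φ) a (fun h0 ↦ hy ?_) (ha ▸ ⟨y, rfl⟩)
      (LocCohVanish.of_surjective h ?_ φ.surjective_rangeRestrict hv)
    · rw [← ha]
      exact (Submodule.Quotient.mk_eq_zero J).2 h0
    · exact fun a ha ↦ Module.mem_annihilator.1 (hM ▸ ha)
  · by_cases hT : J = ⊤
    · have : Subsingleton (R ⧸ J) := Submodule.Quotient.subsingleton_iff.2 hT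
      exact LocCohVanish.of_subsingleton _
    · obtain ⟨a, b, hab, ha, hb⟩ : ∃ a b, a * b ∈ J ∧ a ∉ J ∧ b ∉ J := by
        by_contra! h0
        exact hp ⟨hT, fun {x y} hxy ↦ or_iff_not_imp_left.2 (h0 x y hxy)⟩
      refine key (Submodule.span R {Submodule.Quotient.mk a}) a ha
        (Submodule.mem_span_singleton_self _) ?_
      have hlt : J < J ⊔ Ideal.span {b} := left_lt_sup.2 fun h ↦
        hb (h (Ideal.mem_span_singleton_self b))
      refine LocCohVanish.of_quotient h (hJ.trans hlt.le) (ih _ hlt (hJ.trans hlt.le)) _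
        fun c hc y ↦ Subtype.ext ?_
      obtain ⟨y, hy⟩ := y
      obtain ⟨r, rfl⟩ := Submodule.mem_span_singleton.1 hy
      obtain ⟨d, hd, z, hz, rfl⟩ := Submodule.mem_sup.1 hc
      obtain ⟨w, rfl⟩ := Ideal.mem_span_singleton'.1 hz
      refine (Submodule.Quotient.mk_eq_zero J (x := (d + w * b) • r • a)).2 ?_
      have : (d + w * b) • r • a = (r * a) * d + (w * r) * (a * b) := by
        simp only [smul_eq_mul]; ring
      rw [this]
      exact J.add_mem (Ideal.mul_mem_left _ _ hd) (Ideal.mul_mem_left _ _ hab)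

end RightExact

/-- If the local cohomology of a finite module `M` vanishes in all degrees at least `i`, then so
does that of every finite module killed by the annihilator of `M`. -/
theorem LocCohVanish.of_annihilator_le [IsNoetherianRing R] {M : Type u} [AddCommGroup M]
    [Module R M] [Module.Finite R M] {i : ℕ} (hM : ∀ m, i ≤ m → LocCohVanish I m M)
    (m : ℕ) (hm : i ≤ m)
    (N : Type u) [AddCommGroup N] [Module R N] [Module.Finite R N]
    (hN : Module.annihilator R M ≤ Module.annihilator R N) : LocCohVanish I m N := by
  obtain ⟨B, hB⟩ := exists_locCohVanish_of_le.{u} I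
  have key (k : ℕ) : ∀ m, i ≤ m → B ≤ m + k → ∀ (N : Type u) [AddCommGroup N] [Module R N]
      [Module.Finite R N], (∀ a ∈ Module.annihilator R M, ∀ y : N, a • y = 0) →
        LocCohVanish I m N := by
    induction k with
    | zero => exact fun m _ hm N _ _ _ _ ↦ hB m hm N
    | succ k ih =>
      intro m hm hk
      have h := ih (m + 1) (by omega) (by omega)
      exact LocCohVanish.of_quotient h le_rfl
        (locCohVanish_quotient_of_annihilator_le h rfl (hM m hm) _ le_rfl)
  exact key B m hm (by omega) N fun a ha ↦ Module.mem_annihilator.1 (hN ha)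

end

end LocalCohomologyVanishing

theorem cohDim_le_iff {R : Type} [CommRing R] {I : Ideal R} {M : Type} [AddCommGroup M]
    [Module R M] {c : WithBot ℕ∞} :
    cohDim R I M ≤ c ↔ ∀ n : ℕ, ¬ LocCohVanish I n M → ((n : ℕ∞) : WithBot ℕ∞) ≤ c := by
  have h (n : ℕ) : Nontrivial (locCoh R I n M) ↔ ¬ LocCohVanish I n M := by
    rw [← subsingleton_localCohomology_iff, not_subsingleton_iff_nontrivial]
    rfl
  refine sSup_le_iff.trans ⟨fun H n hn ↦ H _ ⟨n, rfl, (h n).2 hn⟩, ?_⟩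
  rintro H _ ⟨n, rfl, hn⟩
  exact H n ((h n).1 hn)

/-- The cohomological dimension of finite modules is monotone with respect to reverse inclusion of
annihilators. -/
theorem cohDim_le_of_annihilator_le {R : Type} [CommRing R] [IsNoetherianRing R] {I : Ideal R}
    {M N : Type} [AddCommGroup M] [Module R M] [Module.Finite R M] [AddCommGroup N] [Module R N]
    [Module.Finite R N] (h : Module.annihilator R M ≤ Module.annihilator R N) :
    cohDim R I N ≤ cohDim R I M := by
  refine cohDim_le_iff.2 fun n hn ↦ ?_
  obtain ⟨m, hm, hM⟩ : ∃ m, n ≤ m ∧ ¬ LocCohVanish I m M := by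
    by_contra! H
    exact hn (LocCohVanish.of_annihilator_le H n le_rfl N h)
  exact le_trans (by exact_mod_cast hm) (cohDim_le_iff.1 le_rfl m hM)

/-- For a short exact sequence `0 → M' → M → M'' → 0` of finitely generated modules,
`cd(𝔞, M) = max(cd(𝔞, M'), cd(𝔞, M''))`. -/
theorem cohDim_of_shortExact
    (R : Type) [CommRing R] [IsNoetherianRing R] (𝔞 : Ideal R)
    (M' M M'' : Type) [AddCommGroup M'] [Module R M'] [AddCommGroup M] [Module R M]
    [AddCommGroup M''] [Module R M'']
    [Module.Finite R M'] [Module.Finite R M] [Module.Finite R M'']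
    (f : M' →ₗ[R] M) (g : M →ₗ[R] M'')
    (hf : Function.Injective f) (hg : Function.Surjective g) (hfg : Function.Exact f g) :
    cohDim R 𝔞 M = max (cohDim R 𝔞 M') (cohDim R 𝔞 M'') := by
  refine le_antisymm (cohDim_le_iff.2 fun n hn ↦ ?_) (max_le ?_ ?_)
  · rw [le_max_iff]
    by_cases h : LocCohVanish 𝔞 n M'
    · exact Or.inr (cohDim_le_iff.1 le_rfl n fun h' ↦ hn (LocCohVanish.mid hfg hf hg h h'))
    · exact Or.inl (cohDim_le_iff.1 le_rfl n h)
  · exact cohDim_le_of_annihilator_le (LinearMap.annihilator_le_of_injective f hf)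
  · exact cohDim_le_of_annihilator_le (LinearMap.annihilator_le_of_surjective g hg)
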